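/- Consider the cumulative ppo model with symmetric predictor vectors, i.e. a_{ij} = a_{i,J−j} for all i and j, with feasible parameter space Θ. Let Y : Fin m → Fin J → ℝ be nonnegative counts. Then any order σ₁ (a permutation of {1,…,J}) is equivalent to its reverse order σ₂ defined by σ₂(j) = σ₁(J+1−j) for j = 1,…,J; that is, ⨆_{θ∈Θ} l_{σ₁}(θ) = ⨆_{θ∈Θ} l_{σ₂}(θ). -/

import Mathlib

/-- Linear predictor of the cumulative ppo model: `η_{ij}(θ) = ⟪a_{ij}, β_j⟫ + ⟪b_i, ζ⟫`. -/
noncomputable def cppoEta (m K q r : ℕ) (a : Fin m → Fin K → Fin q → ℝ)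
    (b : Fin m → Fin r → ℝ) (β : Fin K → Fin q → ℝ) (ζ : Fin r → ℝ)
    (i : Fin m) (j : Fin K) : ℝ :=
  (∑ x, a i j x * β j x) + ∑ x, b i x * ζ x

/-- `ρ_{ij}(θ) = exp(η_{ij}(θ)) / (1 + exp(η_{ij}(θ)))`. -/
noncomputable def cppoRho (m K q r : ℕ) (a : Fin m → Fin K → Fin q → ℝ)
    (b : Fin m → Fin r → ℝ) (β : Fin K → Fin q → ℝ) (ζ : Fin r → ℝ)
    (i : Fin m) (j : Fin K) : ℝ :=
  Real.exp (cppoEta m K q r a b β ζ i j) / (1 + Real.exp (cppoEta m K q r a b β ζ i j))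

/-- Category probabilities of the cumulative ppo model (`J = K + 1` categories). -/
noncomputable def cppoPi (m K q r : ℕ) (a : Fin m → Fin K → Fin q → ℝ)
    (b : Fin m → Fin r → ℝ) (β : Fin K → Fin q → ℝ) (ζ : Fin r → ℝ)
    (i : Fin m) (c : Fin (K + 1)) : ℝ :=
  (if h : (c : ℕ) < K then cppoRho m K q r a b β ζ i ⟨c, h⟩ else 1) -
    (if h : 0 < (c : ℕ) then
      cppoRho m K q r a b β ζ i ⟨(c : ℕ) - 1, by have := c.isLt; omega⟩ else 0)

/-- Feasible parameter space of the cumulative ppo model. -/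
def cppoFeasible (m K q : ℕ) (a : Fin m → Fin K → Fin q → ℝ)
    (β : Fin K → Fin q → ℝ) : Prop :=
  ∀ (i : Fin m) (t : Fin (K - 1)),
    (∑ x, a i ⟨(t : ℕ), by have := t.isLt; omega⟩ x * β ⟨(t : ℕ), by have := t.isLt; omega⟩ x) <
      ∑ x, a i ⟨(t : ℕ) + 1, by have := t.isLt; omega⟩ x *
        β ⟨(t : ℕ) + 1, by have := t.isLt; omega⟩ x

theorem cppo_dot_rev (m K q : ℕ) (a : Fin m → Fin K → Fin q → ℝ)
    (hsym : ∀ (i : Fin m) (j : Fin K), a i j = a i j.rev)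
    (β : Fin K → Fin q → ℝ) (i : Fin m) (j : Fin K) :
    (∑ x, a i j x * (fun (j : Fin K) x => - β j.rev x) j x) =
      - ∑ x, a i j.rev x * β j.rev x := by
  rw [hsym i j]
  simp

theorem cppo_rho_rev (m K q r : ℕ) (a : Fin m → Fin K → Fin q → ℝ)
    (hsym : ∀ (i : Fin m) (j : Fin K), a i j = a i j.rev) (b : Fin m → Fin r → ℝ)
    (β : Fin K → Fin q → ℝ) (ζ : Fin r → ℝ) (i : Fin m) (j : Fin K) :
    cppoRho m K q r a b (fun j x => - β j.rev x) (fun x => - ζ x) i j =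
      1 - cppoRho m K q r a b β ζ i j.rev := by
  have h : cppoEta m K q r a b (fun j x => - β j.rev x) (fun x => - ζ x) i j =
      - cppoEta m K q r a b β ζ i j.rev := by
    unfold cppoEta
    rw [cppo_dot_rev m K q a hsym β i j]
    simp
    ring
  unfold cppoRho
  rw [h, Real.exp_neg]
  have := Real.exp_pos (cppoEta m K q r a b β ζ i j.rev)
  field_simp
  ring

theorem cppo_pi_rev (m K q r : ℕ) (a : Fin m → Fin K → Fin q → ℝ)
    (hsym : ∀ (i : Fin m) (j : Fin K), a i j = a i j.rev) (b : Fin m → Fin r → ℝ)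
    (β : Fin K → Fin q → ℝ) (ζ : Fin r → ℝ) (i : Fin m) (c : Fin (K + 1)) :
    cppoPi m K q r a b (fun j x => - β j.rev x) (fun x => - ζ x) i c =
      cppoPi m K q r a b β ζ i c.rev := by
  have hc := c.isLt
  unfold cppoPi
  simp only [cppo_rho_rev m K q r a hsym, Fin.val_rev]
  have e1 : ∀ (h : (c : ℕ) < K) (h' : K + 1 - ((c : ℕ) + 1) - 1 < K),
      (⟨K + 1 - ((c : ℕ) + 1) - 1, h'⟩ : Fin K) = Fin.rev ⟨c, h⟩ := by
    intro h h'
    ext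
    simp only [Fin.val_rev]
    omega
  have e2 : ∀ (h0 : 0 < (c : ℕ)) (h : (c : ℕ) - 1 < K) (h' : K + 1 - ((c : ℕ) + 1) < K),
      (⟨K + 1 - ((c : ℕ) + 1), h'⟩ : Fin K) = Fin.rev ⟨(c : ℕ) - 1, h⟩ := by
    intro h0 h h'
    ext
    simp only [Fin.val_rev]
    omega
  by_cases h1 : (c : ℕ) < K
  · have h1' : 0 < K + 1 - ((c : ℕ) + 1) := by omega
    rw [dif_pos h1, dif_pos h1', e1 h1]
    by_cases h2 : 0 < (c : ℕ)
    · have h2' : K + 1 - ((c : ℕ) + 1) < K := by omega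
      rw [dif_pos h2, dif_pos h2', e2 h2 (by omega)]
      ring
    · have h2' : ¬ K + 1 - ((c : ℕ) + 1) < K := by omega
      rw [dif_neg h2, dif_neg h2']
      ring
  · have h1' : ¬ 0 < K + 1 - ((c : ℕ) + 1) := by omega
    rw [dif_neg h1, dif_neg h1']
    by_cases h2 : 0 < (c : ℕ)
    · have h2' : K + 1 - ((c : ℕ) + 1) < K := by omega
      rw [dif_pos h2, dif_pos h2', e2 h2 (by omega)]
      ring
    · have h2' : ¬ K + 1 - ((c : ℕ) + 1) < K := by omega
      rw [dif_neg h2, dif_neg h2']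

theorem cppo_feasible_rev (m K q : ℕ) (a : Fin m → Fin K → Fin q → ℝ)
    (hsym : ∀ (i : Fin m) (j : Fin K), a i j = a i j.rev)
    (β : Fin K → Fin q → ℝ) (h : cppoFeasible m K q a β) :
    cppoFeasible m K q a (fun j x => - β j.rev x) := by
  intro i t
  have ht := t.isLt
  rw [cppo_dot_rev m K q a hsym β i, cppo_dot_rev m K q a hsym β i, neg_lt_neg_iff]
  have := h i t.rev
  have e1 : ∀ h1 h2, (⟨(t.rev : ℕ), h1⟩ : Fin K) = Fin.rev ⟨(t : ℕ) + 1, h2⟩ := by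
    intro h1 h2
    ext
    simp only [Fin.val_rev]
    omega
  have e2 : ∀ h1 h2, (⟨(t.rev : ℕ) + 1, h1⟩ : Fin K) = Fin.rev ⟨(t : ℕ), h2⟩ := by
    intro h1 h2
    ext
    simp only [Fin.val_rev]
    omega
  rw [e1 _ (by omega), e2 _ (by omega)] at this
  exact this

/-- In the cumulative ppo model with symmetric predictor vectors
(`a i j = a i j.rev`), any order `σ₁` is equivalent to its reverse order `σ₂`
(`σ₂(j) = σ₁(J+1−j)`, i.e. `σ₂ j = σ₁ j.rev`): the suprema of the reduced log-likelihood
over the feasible parameter space coincide. -/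
theorem cumulative_ppo_reverse_order_equivalent
    (m K q r : ℕ) (hm : 1 ≤ m) (hK : 2 ≤ K)
    (a : Fin m → Fin K → Fin q → ℝ) (b : Fin m → Fin r → ℝ)
    (hsym : ∀ (i : Fin m) (j : Fin K), a i j = a i j.rev)
    (Y : Fin m → Fin (K + 1) → ℝ) (hY : ∀ i j, 0 ≤ Y i j)
    (σ₁ σ₂ : Equiv.Perm (Fin (K + 1)))
    (hσ₂ : ∀ j : Fin (K + 1), σ₂ j = σ₁ j.rev) :
    (⨆ p : {p : (Fin K → Fin q → ℝ) × (Fin r → ℝ) // cppoFeasible m K q a p.1},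
        ∑ i, ∑ j, Y i (σ₁ j) * Real.log (cppoPi m K q r a b p.1.1 p.1.2 i j)) =
    (⨆ p : {p : (Fin K → Fin q → ℝ) × (Fin r → ℝ) // cppoFeasible m K q a p.1},
        ∑ i, ∑ j, Y i (σ₂ j) * Real.log (cppoPi m K q r a b p.1.1 p.1.2 i j)) := by
  let f : {p : (Fin K → Fin q → ℝ) × (Fin r → ℝ) // cppoFeasible m K q a p.1} →
      {p : (Fin K → Fin q → ℝ) × (Fin r → ℝ) // cppoFeasible m K q a p.1} :=
    fun p => ⟨(fun j x => - p.1.1 j.rev x, fun x => - p.1.2 x),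
      cppo_feasible_rev m K q a hsym p.1.1 p.2⟩
  have hf : Function.Involutive f := by
    intro p
    apply Subtype.ext
    simp [f]
  refine Function.Surjective.iSup_congr f hf.surjective ?_
  intro p
  refine Finset.sum_congr rfl fun i _ => ?_
  rw [← Equiv.sum_comp Fin.revPerm]
  refine Finset.sum_congr rfl fun j _ => ?_
  simp only [f, Fin.revPerm_apply, hσ₂, Fin.rev_rev, cppo_pi_rev m K q r a hsym]
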